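/- Let ℓ be an odd prime and let M be an invertible 2×2 matrix over 𝔽_ℓ with trace t and determinant q such that t² − 4q is not a square in 𝔽_ℓ. Let e be the least positive integer such that M^e is a scalar matrix. Then e > 1, e divides ℓ + 1, and for every one-dimensional 𝔽_ℓ-subspace U of 𝔽_ℓ², the least positive integer k with M^k·U = U equals e. -/

import Mathlib

open Matrix

theorem aux_sq {F : Type*} [Field F] (M : Matrix (Fin 2) (Fin 2) F) :
    ((2:F) • M - M.trace • 1) * ((2:F) • M - M.trace • 1)
      = (M.trace ^ 2 - 4 * M.det) • (1 : Matrix (Fin 2) (Fin 2) F) := by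
  ext i j
  fin_cases i <;> fin_cases j <;>
    simp [Matrix.mul_apply, Fin.sum_univ_two, Matrix.trace_fin_two, Matrix.det_fin_two] <;> ring

theorem aux_ch {F : Type*} [Field F] (M : Matrix (Fin 2) (Fin 2) F) :
    M * M = M.trace • M - M.det • (1 : Matrix (Fin 2) (Fin 2) F) := by
  ext i j
  fin_cases i <;> fin_cases j <;>
    simp [Matrix.mul_apply, Fin.sum_univ_two, Matrix.trace_fin_two, Matrix.det_fin_two] <;> ring

theorem aux_pow {F : Type*} [Field F] (M : Matrix (Fin 2) (Fin 2) F) (k : ℕ) :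
    ∃ a b : F, M ^ k = a • (1 : Matrix (Fin 2) (Fin 2) F) + b • M := by
  induction k with
  | zero => exact ⟨1, 0, by simp⟩
  | succ k ih =>
    obtain ⟨a, b, h⟩ := ih
    refine ⟨-(b * M.det), a + b * M.trace, ?_⟩
    rw [pow_succ, h, add_mul, smul_mul_assoc, smul_mul_assoc, aux_ch, one_mul]
    module

theorem aux_noeig {F : Type*} [Field F] (M : Matrix (Fin 2) (Fin 2) F)
    (hns : ¬ IsSquare (M.trace ^ 2 - 4 * M.det)) (v : Fin 2 → F) (hv : v ≠ 0) (c : F)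
    (h : M *ᵥ v = c • v) : False := by
  apply hns
  have h1 : ((2:F) • M - M.trace • 1) *ᵥ v = (2 * c - M.trace) • v := by
    rw [Matrix.sub_mulVec, Matrix.smul_mulVec, Matrix.smul_mulVec, h, Matrix.one_mulVec]
    module
  have h2 := congrArg (fun A => A *ᵥ v) (aux_sq M)
  simp only [← Matrix.mulVec_mulVec, h1, Matrix.mulVec_smul, Matrix.smul_mulVec,
    Matrix.one_mulVec, smul_smul] at h2
  exact ⟨_, (smul_left_injective F hv h2).symm⟩

theorem aux_frob (ℓ : ℕ) [Fact (Nat.Prime ℓ)] (hodd : Odd ℓ)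
    (M : Matrix (Fin 2) (Fin 2) (ZMod ℓ))
    (hns : ¬ IsSquare (M.trace ^ 2 - 4 * M.det)) :
    M ^ (ℓ + 1) = M.det • (1 : Matrix (Fin 2) (Fin 2) (ZMod ℓ)) := by
  have hl2 : ℓ ≠ 2 := by rintro rfl; exact absurd hodd (by decide)
  have h2 : (2 : ZMod ℓ) ≠ 0 := by
    apply Ring.two_ne_zero
    rwa [ZMod.ringChar_zmod_n]
  set D := M.trace ^ 2 - 4 * M.det with hD
  set N : Matrix (Fin 2) (Fin 2) (ZMod ℓ) := (2 : ZMod ℓ) • M - M.trace • 1 with hN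
  have hNN : N * N = D • 1 := aux_sq M
  have hD0 : D ≠ 0 := by intro h; apply hns; rw [h]; exact IsSquare.zero
  have hpow : D ^ (ℓ / 2) = -1 := by
    rcases ZMod.pow_div_two_eq_neg_one_or_one ℓ hD0 with h | h
    · exact absurd ((ZMod.euler_criterion ℓ hD0).2 h) hns
    · exact h
  have hNl : N ^ ℓ = - N := by
    obtain ⟨m, hm⟩ := hodd
    have : ℓ / 2 = m := by omega
    rw [this] at hpow
    have hx : N ^ ℓ = N ^ (2 * m + 1) := congrArg (N ^ ·) hm
    rw [hx, pow_succ, pow_mul, pow_two, hNN, smul_pow, hpow, one_pow]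
    simp
  have hM2 : (2 : ZMod ℓ) • M = M.trace • 1 + N := by rw [hN]; abel
  have hf : (2 : ZMod ℓ) • M ^ ℓ = M.trace • 1 - N := by
    have h : ((2 : ZMod ℓ) • M) ^ ℓ = (M.trace • 1 + N) ^ ℓ := by rw [hM2]
    rw [add_pow_char_of_commute ℓ ((Commute.one_left N).smul_left _), smul_pow, smul_pow,
      ZMod.pow_card, ZMod.pow_card, one_pow, hNl] at h
    rw [h]; abel
  have h4 : ((2 : ZMod ℓ) * 2) • M ^ (ℓ + 1) = ((2 : ZMod ℓ) * 2) • (M.det • 1) := by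
    have : ((2 : ZMod ℓ) * 2) • M ^ (ℓ + 1) = ((2 : ZMod ℓ) • M ^ ℓ) * ((2 : ZMod ℓ) • M) := by
      rw [smul_mul_smul_comm, pow_succ]
    rw [this, hf, hM2, sub_mul, mul_add, mul_add, hNN, hD]
    simp only [smul_mul_assoc, mul_smul_comm, one_mul, mul_one]
    module
  exact smul_right_injective _ (mul_ne_zero h2 h2) h4

/-- If M is an invertible 2×2 matrix over 𝔽_ℓ with trace t and determinant q such that
t² − 4q is not a square in 𝔽_ℓ, and e is the least positive integer with M^e scalar,
then e > 1, e divides ℓ + 1, and for every one-dimensional subspace U of 𝔽_ℓ² the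
least positive integer k with M^k·U = U equals e. -/
theorem stmt11 (ℓ : ℕ) [Fact (Nat.Prime ℓ)] (hodd : Odd ℓ)
    (M : Matrix (Fin 2) (Fin 2) (ZMod ℓ)) (hM : IsUnit M)
    (t q : ZMod ℓ) (ht : M.trace = t) (hq : M.det = q)
    (hns : ¬ IsSquare (t ^ 2 - 4 * q))
    (e : ℕ)
    (he : IsLeast {k : ℕ | 0 < k ∧
      ∃ c : ZMod ℓ, M ^ k = c • (1 : Matrix (Fin 2) (Fin 2) (ZMod ℓ))} e) :
    1 < e ∧ e ∣ ℓ + 1 ∧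
      ∀ U : Submodule (ZMod ℓ) (Fin 2 → ZMod ℓ), Module.finrank (ZMod ℓ) U = 1 →
        IsLeast {k : ℕ | 0 < k ∧ U.map (Matrix.toLin' (M ^ k)) = U} e := by
  subst ht hq
  obtain ⟨⟨he0, c, hc⟩, hmin⟩ := he
  have hc0 : c ≠ 0 := by
    rintro rfl
    have := hM.pow e
    rw [hc, zero_smul] at this
    exact not_isUnit_zero this
  refine ⟨?_, ?_, ?_⟩
  · by_contra hlt
    have h1 : e = 1 := by omega
    rw [h1, pow_one] at hc
    apply aux_noeig M hns (fun _ => 1) (fun h => one_ne_zero (congrFun h 0)) c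
    rw [hc, Matrix.smul_mulVec, Matrix.one_mulVec]
  · by_contra hnd
    have hr : 0 < (ℓ + 1) % e := by
      rcases Nat.eq_zero_or_pos ((ℓ + 1) % e) with h | h
      · exact absurd (Nat.dvd_of_mod_eq_zero h) hnd
      · exact h
    have hF := aux_frob ℓ hodd M hns
    rw [← Nat.mod_add_div (ℓ + 1) e, pow_add, pow_mul, hc, smul_pow, one_pow, mul_smul_comm,
      mul_one] at hF
    have hle := hmin ⟨hr, (c ^ ((ℓ + 1) / e))⁻¹ * M.det, by
      rw [mul_smul, ← hF, inv_smul_smul₀ (pow_ne_zero _ hc0)]⟩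
    exact absurd (Nat.mod_lt (ℓ + 1) he0) (by omega)
  · intro U hU
    refine ⟨⟨he0, ?_⟩, ?_⟩
    · rw [hc, map_smul, Matrix.toLin'_one, Submodule.map_smul _ _ _ hc0, Submodule.map_id]
    · rintro k ⟨hk, hmap⟩
      apply hmin
      refine ⟨hk, ?_⟩
      obtain ⟨⟨v, hvU⟩, hv0, hspan⟩ := finrank_eq_one_iff'.1 hU
      have hv : v ≠ 0 := fun h => hv0 (Subtype.ext h)
      have hmem : (M ^ k) *ᵥ v ∈ U := by
        rw [← hmap]
        exact ⟨v, hvU, Matrix.toLin'_apply _ _⟩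
      obtain ⟨d, hd⟩ := hspan ⟨_, hmem⟩
      have hd' : d • v = (M ^ k) *ᵥ v := congrArg Subtype.val hd
      obtain ⟨a, b, hab⟩ := aux_pow M k
      by_cases hb : b = 0
      · exact ⟨a, by rw [hab, hb]; simp⟩
      · exfalso
        apply aux_noeig M hns v hv (b⁻¹ * (d - a))
        rw [hab, Matrix.add_mulVec, Matrix.smul_mulVec, Matrix.smul_mulVec,
          Matrix.one_mulVec] at hd'
        rw [mul_smul, sub_smul, hd', add_sub_cancel_left, inv_smul_smul₀ hb]
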